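/- arXiv:1212.1884 — 2 statements merged into one kernel-verified Lean document; each statement's English description precedes it below -/
import Mathlib

section
/- Let 𝒢 be an n-player potential game with potential Φ where each player has at most m strategies, and let ΔΦ be the maximum global variation of Φ. Let P be the transition matrix of the logit dynamics for 𝒢 with inverse noise β ≥ 0, with eigenvalues 1 = λ_1 ≥ λ_2 ≥ ⋯ ≥ λ_{|S|}. Then 1 − λ_2 ≥ 1/(2·m·n·e^{β·ΔΦ}); consequently (since all eigenvalues of P are nonnegative) the relaxation time satisfies t_rel = 1/(1 − λ_2) ≤ 2·m·n·e^{β·ΔΦ}. -/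
noncomputable section

open Finset

variable {n : ℕ} {S : Fin n → Type*} [∀ i, Fintype (S i)] [∀ i, DecidableEq (S i)]
  [∀ i, Nonempty (S i)]

/-- Logit update probability `σ_i(z ∣ x)` with inverse noise `β` for the game with
utilities `u`. -/
def logitSigma (β : ℝ) (u : Fin n → (∀ i, S i) → ℝ) (i : Fin n) (z : S i)
    (x : ∀ i, S i) : ℝ :=
  Real.exp (β * u i (Function.update x i z)) /
    ∑ w : S i, Real.exp (β * u i (Function.update x i w))

/-- Transition matrix of the logit dynamics with inverse noise `β`:
`P x y = (1/n) · σ_i(y_i ∣ x)` if `x` and `y` differ exactly in coordinate `i`,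
`P x x = (1/n) · ∑ i, σ_i(x_i ∣ x)`, and `P x y = 0` otherwise. -/
def logitP (β : ℝ) (u : Fin n → (∀ i, S i) → ℝ) :
    Matrix (∀ i, S i) (∀ i, S i) ℝ := fun x y =>
  (1 / (n : ℝ)) *
    ∑ i, if y = Function.update x i (y i) then logitSigma β u i (y i) x else 0

/-- `Φ` is an (exact) potential for the game with utilities `u`. -/
def IsPotential (u : Fin n → (∀ i, S i) → ℝ) (Φ : (∀ i, S i) → ℝ) : Prop :=
  ∀ (i : Fin n) (a b : S i) (x : ∀ i, S i),
    u i (Function.update x i a) - u i (Function.update x i b) =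
      Φ (Function.update x i b) - Φ (Function.update x i a)

/-- The Gibbs measure `π(x) = exp(−β·Φ(x))/Z`. -/
def gibbs (β : ℝ) (Φ : (∀ i, S i) → ℝ) (x : ∀ i, S i) : ℝ :=
  Real.exp (-β * Φ x) / ∑ y : ∀ i, S i, Real.exp (-β * Φ y)

/-- Total variation distance `(1/2)·∑ z, |μ z − ν z|`. -/
def tvDist {α : Type*} [Fintype α] (μ ν : α → ℝ) : ℝ :=
  (1 / 2) * ∑ z, |μ z - ν z|

/-- Maximum global variation `ΔΦ = max Φ − min Φ`. -/
def maxVar (Φ : (∀ i, S i) → ℝ) : ℝ :=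
  sSup {d : ℝ | ∃ x y : ∀ i, S i, d = Φ x - Φ y}

/-- Two profiles are adjacent if they differ in exactly one coordinate. -/
def Adjacent (x y : ∀ i, S i) : Prop :=
  (Finset.univ.filter fun i => x i ≠ y i).card = 1

/-- Maximum local variation `δΦ`. -/
def localVar (Φ : (∀ i, S i) → ℝ) : ℝ :=
  sSup {d : ℝ | ∃ x y : ∀ i, S i, Adjacent x y ∧ d = Φ x - Φ y}

set_option linter.unusedSectionVars false

/-- Average of `v` over the line through `x` in direction `i`, with respect to the weight `W`. -/
def lineAvg (W : (∀ i, S i) → ℝ) (i : Fin n) (v : (∀ i, S i) → ℝ) (x : ∀ i, S i) : ℝ :=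
  (∑ z : S i, W (Function.update x i z) * v (Function.update x i z)) /
    ∑ z : S i, W (Function.update x i z)

/-- `k` does not depend on the coordinate `i`. -/
def InvariantAt (i : Fin n) (k : (∀ i, S i) → ℝ) : Prop :=
  ∀ (x : ∀ i, S i) (z : S i), k (Function.update x i z) = k x

lemma lineAvg_invariantAt (W : (∀ i, S i) → ℝ) (i : Fin n) (v : (∀ i, S i) → ℝ) :
    InvariantAt i (lineAvg W i v) := by
  intro x z
  simp [lineAvg]

lemma lineAvg_one_invariantAt_of_ne {i j : Fin n} (hij : i ≠ j) {v : (∀ i, S i) → ℝ}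
    (hv : InvariantAt i v) : InvariantAt i (lineAvg (fun _ => 1) j v) := by
  intro x z
  simp only [lineAvg]
  simp_rw [Function.update_comm hij, hv _ z]

lemma sum_sum_update_swap (i : Fin n) (F : (∀ i, S i) → (∀ i, S i) → ℝ) :
    ∑ x, ∑ z : S i, F x (Function.update x i z) =
      ∑ x, ∑ z : S i, F (Function.update x i z) x := by
  rw [← Fintype.sum_prod_type', ← Fintype.sum_prod_type']
  let swap : (∀ i, S i) × S i → (∀ i, S i) × S i := fun p => (Function.update p.1 i p.2, p.1 i)
  have hswap : Function.Involutive swap := fun p => by simp [swap]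
  exact Fintype.sum_equiv hswap.toPerm _ _ fun p => by simp [swap]

lemma sum_mul_lineAvg_mul {W : (∀ i, S i) → ℝ} (hW : ∀ x, 0 < W x) (i : Fin n)
    (v : (∀ i, S i) → ℝ) {k : (∀ i, S i) → ℝ} (hk : InvariantAt i k) :
    ∑ x, W x * lineAvg W i v x * k x = ∑ x, W x * v x * k x := by
  let N : (∀ i, S i) → ℝ := fun x => ∑ z : S i, W (Function.update x i z)
  have hN : ∀ x, 0 < N x := fun x => Finset.sum_pos (fun z _ => hW _) Finset.univ_nonempty
  have hNinv : InvariantAt i N := fun x z => by simp [N]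
  have h := sum_sum_update_swap i fun x y => W x * (W y * v y) * k x / N x
  calc ∑ x, W x * lineAvg W i v x * k x
      = ∑ x, ∑ z : S i, W x * (W (Function.update x i z) * v (Function.update x i z)) *
          k x / N x := by
        refine Finset.sum_congr rfl fun x _ => ?_
        rw [← Finset.sum_div, ← Finset.sum_mul, ← Finset.mul_sum]
        simp only [lineAvg, N]
        ring
    _ = ∑ x, N x * (W x * v x * k x / N x) := by
        rw [h]
        refine Finset.sum_congr rfl fun x _ => ?_
        simp only [hk x, hNinv x]
        rw [Finset.sum_mul]
        exact Finset.sum_congr rfl fun z _ => by ring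
    _ = ∑ x, W x * v x * k x :=
        Finset.sum_congr rfl fun x _ => mul_div_cancel₀ _ (hN x).ne'

lemma sum_mul_sq_sub_eq {W : (∀ i, S i) → ℝ} (hW : ∀ x, 0 < W x) (i : Fin n)
    (v : (∀ i, S i) → ℝ) {k : (∀ i, S i) → ℝ} (hk : InvariantAt i k) :
    ∑ x, W x * (v x - k x) ^ 2 =
      ∑ x, W x * (v x - lineAvg W i v x) ^ 2 + ∑ x, W x * (lineAvg W i v x - k x) ^ 2 := by
  have h : InvariantAt i fun x => lineAvg W i v x - k x := fun x z => by
    simp only [hk x z, lineAvg_invariantAt W i v x z]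
  have horth := sum_mul_lineAvg_mul hW i v h
  have hexp : ∑ x, W x * (v x - k x) ^ 2 =
      ∑ x, W x * (v x - lineAvg W i v x) ^ 2 + ∑ x, W x * (lineAvg W i v x - k x) ^ 2 +
        2 * (∑ x, W x * v x * (lineAvg W i v x - k x) -
          ∑ x, W x * lineAvg W i v x * (lineAvg W i v x - k x)) := by
    rw [← Finset.sum_sub_distrib, Finset.mul_sum, ← Finset.sum_add_distrib,
      ← Finset.sum_add_distrib]
    exact Finset.sum_congr rfl fun x _ => by ring
  rw [hexp, horth, sub_self, mul_zero, add_zero]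

lemma sum_sq_lineAvg_one_sub_le (i : Fin n) (v w : (∀ i, S i) → ℝ) :
    ∑ x, (lineAvg (fun _ => 1) i v x - lineAvg (fun _ => 1) i w x) ^ 2 ≤
      ∑ x, (v x - w x) ^ 2 := by
  have h := sum_mul_sq_sub_eq (W := fun _ => 1) (fun _ => one_pos) i (fun x => v x - w x)
    (k := fun _ => 0) fun _ _ => rfl
  have hlin : ∀ x, lineAvg (fun _ => 1) i (fun x => v x - w x) x =
      lineAvg (fun _ => 1) i v x - lineAvg (fun _ => 1) i w x := fun x => by
    simp only [lineAvg, mul_sub, Finset.sum_sub_distrib, sub_div]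
  simp only [hlin, one_mul, sub_zero] at h
  rw [h]
  exact le_add_of_nonneg_left (Finset.sum_nonneg fun x _ => sq_nonneg _)

/-- Efron–Stein inequality for the counting measure, restricted to the coordinates in `s`. -/
lemma exists_invariantAt_sum_sq_sub_le (v : (∀ i, S i) → ℝ) (s : Finset (Fin n)) :
    ∃ g : (∀ i, S i) → ℝ, (∀ i ∈ s, InvariantAt i g) ∧
      ∑ x, (v x - g x) ^ 2 ≤ ∑ i ∈ s, ∑ x, (v x - lineAvg (fun _ => 1) i v x) ^ 2 := by
  induction s using Finset.induction_on with
  | empty => exact ⟨v, by simp, by simp⟩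
  | insert j s hj ih =>
    obtain ⟨g, hg, hle⟩ := ih
    refine ⟨lineAvg (fun _ => 1) j g, fun i hi => ?_, ?_⟩
    · by_cases hij : i = j
      · subst hij
        exact lineAvg_invariantAt _ _ _
      · exact lineAvg_one_invariantAt_of_ne hij (hg i (Finset.mem_of_mem_insert_of_ne hi hij))
    · have h := sum_mul_sq_sub_eq (W := fun _ => 1) (fun _ => one_pos) j v
        (lineAvg_invariantAt (fun _ => 1) j g)
      simp only [one_mul] at h
      rw [Finset.sum_insert hj, h]
      exact add_le_add_right ((sum_sq_lineAvg_one_sub_le j v g).trans hle) _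

lemma eq_of_forall_invariantAt {g : (∀ i, S i) → ℝ} (hg : ∀ i, InvariantAt i g)
    (x y : ∀ i, S i) : g x = g y := by
  have h : ∀ s : Finset (Fin n), g (s.piecewise y x) = g x := fun s => by
    induction s using Finset.induction_on with
    | empty => simp
    | insert j s hj ih => rw [Finset.piecewise_insert, hg j, ih]
  simpa using (h Finset.univ).symm

/-- Efron–Stein inequality for the counting measure. -/
lemma exists_sum_sq_sub_const_le (v : (∀ i, S i) → ℝ) :
    ∃ c : ℝ, ∑ x, (v x - c) ^ 2 ≤ ∑ i, ∑ x, (v x - lineAvg (fun _ => 1) i v x) ^ 2 := by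
  obtain ⟨g, hg, hle⟩ := exists_invariantAt_sum_sq_sub_le v Finset.univ
  refine ⟨g (Classical.arbitrary _), ?_⟩
  convert hle using 4 with x
  exact eq_of_forall_invariantAt (fun i => hg i (Finset.mem_univ i)) _ _

/-- Poincaré inequality for a weight whose values vary by a factor of at most `R`. -/
lemma sum_mul_sq_le_of_forall_le {W : (∀ i, S i) → ℝ} (hW : ∀ x, 0 < W x) {R : ℝ}
    (hR : ∀ x y, W x ≤ R * W y) {v : (∀ i, S i) → ℝ} (hv : ∑ x, W x * v x = 0) :
    ∑ x, W x * v x ^ 2 ≤ R * ∑ i, ∑ x, W x * (v x - lineAvg W i v x) ^ 2 := by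
  obtain ⟨c, hc⟩ := exists_sum_sq_sub_const_le v
  obtain ⟨x₀, hx₀⟩ := Finite.exists_max W
  have hcenter : ∑ x, W x * (v x - c) ^ 2 =
      ∑ x, W x * v x ^ 2 - 2 * c * ∑ x, W x * v x + ∑ x, W x * c ^ 2 := by
    rw [Finset.mul_sum, ← Finset.sum_sub_distrib, ← Finset.sum_add_distrib]
    exact Finset.sum_congr rfl fun x _ => by ring
  calc ∑ x, W x * v x ^ 2
      ≤ ∑ x, W x * (v x - c) ^ 2 := by
        rw [hcenter, hv, mul_zero, sub_zero]
        exact le_add_of_nonneg_right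
          (Finset.sum_nonneg fun x _ => mul_nonneg (hW x).le (sq_nonneg c))
    _ ≤ W x₀ * ∑ x, (v x - c) ^ 2 := by
        rw [Finset.mul_sum]
        exact Finset.sum_le_sum fun x _ => mul_le_mul_of_nonneg_right (hx₀ x) (sq_nonneg _)
    _ ≤ W x₀ * ∑ i, ∑ x, (v x - lineAvg W i v x) ^ 2 := by
        refine mul_le_mul_of_nonneg_left (hc.trans (Finset.sum_le_sum fun i _ => ?_)) (hW x₀).le
        have h := sum_mul_sq_sub_eq (W := fun _ => 1) (fun _ => one_pos) i v
          (lineAvg_invariantAt W i v)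
        simp only [one_mul] at h
        rw [h]
        exact le_add_of_nonneg_right (Finset.sum_nonneg fun x _ => sq_nonneg _)
    _ ≤ R * ∑ i, ∑ x, W x * (v x - lineAvg W i v x) ^ 2 := by
        simp only [Finset.mul_sum]
        refine Finset.sum_le_sum fun i _ => Finset.sum_le_sum fun x _ => ?_
        rw [← mul_assoc]
        exact mul_le_mul_of_nonneg_right (hR x₀ x) (sq_nonneg _)

lemma logitSigma_eq {u : Fin n → (∀ i, S i) → ℝ} {Φ : (∀ i, S i) → ℝ}
    (hpot : IsPotential u Φ) (β : ℝ) (i : Fin n) (z : S i) (x : ∀ i, S i) :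
    logitSigma β u i z x = Real.exp (-β * Φ (Function.update x i z)) /
      ∑ w : S i, Real.exp (-β * Φ (Function.update x i w)) := by
  have h : ∀ w : S i, Real.exp (β * u i (Function.update x i w)) =
      Real.exp (β * (u i x + Φ x)) * Real.exp (-β * Φ (Function.update x i w)) := fun w => by
    have hw := hpot i w (x i) x
    rw [Function.update_eq_self] at hw
    rw [← Real.exp_add]
    congr 1
    linear_combination β * hw
  simp only [logitSigma, h, ← Finset.mul_sum]
  exact mul_div_mul_left _ _ (Real.exp_ne_zero _)

lemma logitP_mulVec_eq {u : Fin n → (∀ i, S i) → ℝ} {Φ : (∀ i, S i) → ℝ}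
    (hpot : IsPotential u Φ) (β : ℝ) (v : (∀ i, S i) → ℝ) (x : ∀ i, S i) :
    (logitP β u).mulVec v x =
      1 / (n : ℝ) * ∑ i, lineAvg (fun y => Real.exp (-β * Φ y)) i v x := by
  have hline : ∀ i : Fin n,
      ∑ y, (if y = Function.update x i (y i) then logitSigma β u i (y i) x else 0) * v y =
        lineAvg (fun y => Real.exp (-β * Φ y)) i v x := fun i => by
    have himage : (Finset.univ.filter fun y : ∀ i, S i => y = Function.update x i (y i)) =
        Finset.univ.image fun z : S i => Function.update x i z := by
      ext y
      simp only [Finset.mem_filter, Finset.mem_univ, true_and, Finset.mem_image]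
      refine ⟨fun h => ⟨y i, h.symm⟩, ?_⟩
      rintro ⟨z, rfl⟩
      simp
    simp only [ite_mul, zero_mul]
    rw [← Finset.sum_filter, himage,
      Finset.sum_image (Function.update_injective x i).injOn, lineAvg, Finset.sum_div]
    refine Finset.sum_congr rfl fun z _ => ?_
    rw [Function.update_self, logitSigma_eq hpot]
    ring
  simp only [Matrix.mulVec, dotProduct, logitP, mul_assoc, Finset.sum_mul]
  rw [← Finset.mul_sum, Finset.sum_comm]
  simp only [hline]

lemma sub_le_maxVar (Φ : (∀ i, S i) → ℝ) (x y : ∀ i, S i) : Φ x - Φ y ≤ maxVar Φ := by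
  refine le_csSup (Set.Finite.bddAbove ?_) ⟨x, y, rfl⟩
  refine (Set.finite_range fun p : (∀ i, S i) × (∀ i, S i) => Φ p.1 - Φ p.2).subset ?_
  rintro d ⟨a, b, rfl⟩
  exact ⟨(a, b), rfl⟩

/-- For an `n`-player potential game where each player has at most `m`
strategies, every eigenvalue `λ ≠ 1` of the logit dynamics transition matrix satisfies
`λ ≤ 1 − 1/(2·m·n·e^{β·ΔΦ})`, i.e. `1 − λ₂ ≥ 1/(2·m·n·e^{β·ΔΦ})`, so the relaxation
time is at most `2·m·n·e^{β·ΔΦ}`. -/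
theorem logit_relaxation_upper_bound
    (hn : 1 ≤ n) (m : ℕ) (hm : ∀ i, Fintype.card (S i) ≤ m)
    (u : Fin n → (∀ i, S i) → ℝ) (Φ : (∀ i, S i) → ℝ)
    (hpot : IsPotential u Φ) (β : ℝ) (hβ : 0 ≤ β) :
    ∀ (lam : ℝ) (v : (∀ i, S i) → ℝ), v ≠ 0 →
      (logitP β u).mulVec v = lam • v → lam ≠ 1 →
      lam ≤ 1 - 1 / (2 * (m : ℝ) * (n : ℝ) * Real.exp (β * maxVar Φ)) := by
  intro lam v hv0 heig hlam
  let W : (∀ i, S i) → ℝ := fun x => Real.exp (-β * Φ x)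
  have hW : ∀ x, 0 < W x := fun x => Real.exp_pos _
  have hn0 : (0 : ℝ) < n := by exact_mod_cast hn
  have hstep : ∀ x, n * (lam * v x) = ∑ i, lineAvg W i v x := fun x => by
    have h := congrFun heig x
    rw [logitP_mulVec_eq hpot, Pi.smul_apply, smul_eq_mul] at h
    rw [← h, ← mul_assoc, mul_one_div_cancel hn0.ne', one_mul]
  have hpair : ∀ k : (∀ i, S i) → ℝ,
      n * (lam * ∑ x, W x * v x * k x) = ∑ i, ∑ x, W x * lineAvg W i v x * k x := fun k => by
    rw [Finset.sum_comm, Finset.mul_sum, Finset.mul_sum]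
    refine Finset.sum_congr rfl fun x _ => ?_
    rw [← Finset.sum_mul, ← Finset.mul_sum, ← hstep]
    ring
  have hmean : ∑ x, W x * v x = 0 := by
    have h := hpair fun _ => 1
    rw [Finset.sum_congr rfl fun i _ => sum_mul_lineAvg_mul hW i v fun _ _ => rfl] at h
    simp only [mul_one, Finset.sum_const, Finset.card_univ, Fintype.card_fin, nsmul_eq_mul] at h
    have h' : (n : ℝ) * (lam - 1) * ∑ x, W x * v x = 0 := by linear_combination h
    exact (mul_eq_zero.1 h').resolve_left (mul_ne_zero hn0.ne' (sub_ne_zero.2 hlam))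
  have henergy : ∑ i, ∑ x, W x * (v x - lineAvg W i v x) ^ 2 =
      n * (1 - lam) * ∑ x, W x * v x ^ 2 := by
    have hi : ∀ i, ∑ x, W x * (v x - lineAvg W i v x) ^ 2 =
        ∑ x, W x * v x ^ 2 - ∑ x, W x * lineAvg W i v x * v x := fun i => by
      have h := sum_mul_lineAvg_mul hW i v (lineAvg_invariantAt W i v)
      have hexp : ∑ x, W x * (v x - lineAvg W i v x) ^ 2 =
          ∑ x, W x * v x ^ 2 - ∑ x, W x * lineAvg W i v x * v x +
            (∑ x, W x * lineAvg W i v x * lineAvg W i v x -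
              ∑ x, W x * v x * lineAvg W i v x) := by
        simp only [← Finset.sum_sub_distrib, ← Finset.sum_add_distrib]
        exact Finset.sum_congr rfl fun x _ => by ring
      rw [hexp, h, sub_self, add_zero]
    have hsq : ∑ x, W x * v x * v x = ∑ x, W x * v x ^ 2 :=
      Finset.sum_congr rfl fun x _ => by ring
    rw [Finset.sum_congr rfl fun i _ => hi i, Finset.sum_sub_distrib, ← hpair v, hsq]
    simp only [Finset.sum_const, Finset.card_univ, Fintype.card_fin, nsmul_eq_mul]
    ring
  set R := Real.exp (β * maxVar Φ) with hRdef
  have hR0 : 0 < R := Real.exp_pos _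
  have hR : ∀ x y, W x ≤ R * W y := fun x y => by
    rw [hRdef, ← Real.exp_add]
    refine Real.exp_le_exp.2 ?_
    linarith [mul_le_mul_of_nonneg_left (sub_le_maxVar Φ y x) hβ]
  have hnorm : 0 < ∑ x, W x * v x ^ 2 := by
    obtain ⟨x, hx⟩ := Function.ne_iff.1 hv0
    exact Finset.sum_pos' (fun y _ => mul_nonneg (hW y).le (sq_nonneg _))
      ⟨x, Finset.mem_univ x, mul_pos (hW x) (sq_pos_of_ne_zero hx)⟩
  have hgap : 1 ≤ R * (n * (1 - lam)) := by
    have h := sum_mul_sq_le_of_forall_le hW hR hmean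
    rw [henergy, ← mul_assoc] at h
    exact le_of_mul_le_mul_right (by rwa [one_mul]) hnorm
  have hm1 : (1 : ℝ) ≤ m := by
    exact_mod_cast (Fintype.card_pos (α := S ⟨0, hn⟩)).trans_le (hm ⟨0, hn⟩)
  have hlam1 : 0 ≤ 1 - lam :=
    (pos_of_mul_pos_right (pos_of_mul_pos_right (one_pos.trans_le hgap) hR0.le) hn0.le).le
  rw [le_sub_comm, div_le_iff₀ (by positivity)]
  calc (1 : ℝ) ≤ R * (n * (1 - lam)) := hgap
    _ ≤ (2 * m) * (R * (n * (1 - lam))) :=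
        le_mul_of_one_le_left (by positivity) (by linarith)
    _ = (1 - lam) * (2 * m * n * R) := by ring
end
end

section
/- Fix integers n ≥ 2 and c with 1 ≤ c ≤ n/2 and a real l > 0, and set g = c·l. Consider the n-player potential game in which each player has strategy set {0,1} and every player's utility is u_i(x) = −Φ(x), where Φ(x) = −l·min{c, |c − w(x)|} and w(x) denotes the number of coordinates of x equal to 1 (so Φ is an exact potential for the game). Then the maximum global variation of Φ is ΔΦ = g, the maximum local variation is δΦ = l, and for the logit dynamics with inverse noise β ≥ 0 and every ε ∈ (0,1/2): for every integer t < (1 − 2ε)·e^{β·g}/(2·C(n, c−1)), there exists a starting profile x ∈ {0,1}^n with ‖P^t(x,·) − π‖_TV > ε, where C(n, c−1) is the binomial coefficient. In particular the mixing time satisfies t_mix(ε) ≥ (1 − 2ε)·e^{β·ΔΦ}/(2·C(n, c−1)). -/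
noncomputable section

open Finset

variable {n : ℕ} {S : Fin n → Type*} [∀ i, Fintype (S i)] [∀ i, DecidableEq (S i)]
  [∀ i, Nonempty (S i)]

/-- Number of coordinates equal to `true` (the weight `w(x)`). -/
def wt {n : ℕ} (x : Fin n → Bool) : ℕ := (Finset.univ.filter fun i => x i = true).card

section Bottleneck

variable {α : Type*} [Fintype α] [DecidableEq α] {P : Matrix α α ℝ}

/-- The total variation distance dominates the difference of the masses of any set. -/
lemma sum_sub_sum_le_tvDist {μ ν : α → ℝ} (h : ∑ x, μ x = ∑ x, ν x)
    (A : Finset α) : ∑ x ∈ A, ν x - ∑ x ∈ A, μ x ≤ tvDist μ ν := by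
  have h1 : ∑ x ∈ A, ν x - ∑ x ∈ A, μ x ≤ ∑ x ∈ A, |μ x - ν x| := by
    rw [← Finset.sum_sub_distrib]
    refine Finset.sum_le_sum fun x _ => ?_
    rw [abs_sub_comm]
    exact le_abs_self _
  have h2 : ∑ x ∈ Aᶜ, μ x - ∑ x ∈ Aᶜ, ν x ≤ ∑ x ∈ Aᶜ, |μ x - ν x| := by
    rw [← Finset.sum_sub_distrib]
    exact Finset.sum_le_sum fun x _ => le_abs_self _
  have e1 := Finset.sum_add_sum_compl A μ
  have e2 := Finset.sum_add_sum_compl A ν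
  have e3 := Finset.sum_add_sum_compl A fun x => |μ x - ν x|
  unfold tvDist
  linarith

lemma matrix_pow_row_sum (h1 : ∀ x, ∑ y, P x y = 1) (t : ℕ) (x : α) :
    ∑ y, (P ^ t) x y = 1 := by
  induction t with
  | zero => simp [Matrix.one_apply]
  | succ t ih =>
    simp only [pow_succ, Matrix.mul_apply]
    rw [Finset.sum_comm]
    simpa only [← Finset.mul_sum, h1, mul_one] using ih

/-- The mass that a reversible chain started from the weights `w` restricted to `A` has outside
`A` at time `t` is at most `t` times the flow out of `A` in one step. -/
lemma sum_weight_escape_le (h0 : ∀ x y, 0 ≤ P x y) (h1 : ∀ x, ∑ y, P x y = 1)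
    {w : α → ℝ} (hw : ∀ x, 0 ≤ w x) (hrev : ∀ x y, w x * P x y = w y * P y x)
    (A : Finset α) (t : ℕ) :
    ∑ x ∈ A, w x * ∑ y ∈ Aᶜ, (P ^ t) x y ≤ t * ∑ x ∈ A, w x * ∑ y ∈ Aᶜ, P x y := by
  set f : ℕ → α → ℝ := fun t y => ∑ x ∈ A, w x * (P ^ t) x y with hf
  have fsucc : ∀ t y, f (t + 1) y = ∑ z, f t z * P z y := by
    intro t y
    simp only [hf, pow_succ, Matrix.mul_apply, Finset.mul_sum, Finset.sum_mul]
    rw [Finset.sum_comm]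
    simp only [mul_assoc]
  have fzero : ∀ y, f 0 y = if y ∈ A then w y else 0 := by
    intro y
    simp [hf, Matrix.one_apply]
  have fnonneg : ∀ t y, 0 ≤ f t y := by
    intro t
    induction t with
    | zero => intro y; rw [fzero]; split_ifs <;> simp [hw]
    | succ t ih =>
      intro y
      rw [fsucc]
      exact Finset.sum_nonneg fun z _ => mul_nonneg (ih z) (h0 z y)
  have fle : ∀ t y, f t y ≤ w y := by
    intro t
    induction t with
    | zero => intro y; rw [fzero]; split_ifs <;> simp [hw]
    | succ t ih =>
      intro y
      rw [fsucc]
      calc ∑ z, f t z * P z y ≤ ∑ z, w z * P z y :=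
            Finset.sum_le_sum fun z _ => mul_le_mul_of_nonneg_right (ih z) (h0 z y)
        _ = ∑ z, w y * P y z := Finset.sum_congr rfl fun z _ => hrev z y
        _ = w y := by rw [← Finset.mul_sum, h1, mul_one]
  have key : ∀ t, ∑ y ∈ Aᶜ, f t y ≤ t * ∑ x ∈ A, w x * ∑ y ∈ Aᶜ, P x y := by
    intro t
    induction t with
    | zero =>
      refine le_of_eq ?_
      rw [Nat.cast_zero, zero_mul]
      refine Finset.sum_eq_zero fun y hy => ?_
      rw [fzero, if_neg (Finset.mem_compl.1 hy)]
    | succ t ih =>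
      have e : ∑ y ∈ Aᶜ, f (t + 1) y = ∑ z, f t z * ∑ y ∈ Aᶜ, P z y := by
        simp only [fsucc, Finset.mul_sum]
        rw [Finset.sum_comm]
      rw [e, ← Finset.sum_add_sum_compl A]
      have b1 : ∑ z ∈ A, f t z * ∑ y ∈ Aᶜ, P z y ≤ ∑ z ∈ A, w z * ∑ y ∈ Aᶜ, P z y :=
        Finset.sum_le_sum fun z _ => mul_le_mul_of_nonneg_right (fle t z)
          (Finset.sum_nonneg fun y _ => h0 z y)
      have b2 : ∑ z ∈ Aᶜ, f t z * ∑ y ∈ Aᶜ, P z y ≤ ∑ z ∈ Aᶜ, f t z := by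
        refine Finset.sum_le_sum fun z _ => mul_le_of_le_one_right (fnonneg t z) ?_
        rw [← h1 z]
        exact Finset.sum_le_sum_of_subset_of_nonneg (Finset.subset_univ _)
          fun y _ _ => h0 z y
      push_cast
      linarith
  have e : ∑ x ∈ A, w x * ∑ y ∈ Aᶜ, (P ^ t) x y = ∑ y ∈ Aᶜ, f t y := by
    simp only [hf, Finset.mul_sum]
    rw [Finset.sum_comm]
  rw [e]
  exact key t

end Bottleneck

section Logit

omit [∀ i, Nonempty (S i)] in
lemma sum_ite_eq_update (x : ∀ i, S i) (i : Fin n) (s : Finset (∀ i, S i))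
    (F : (∀ i, S i) → ℝ) :
    (∑ y ∈ s, if y = Function.update x i (y i) then F y else 0) =
      ∑ z, if Function.update x i z ∈ s then F (Function.update x i z) else 0 := by
  rw [← Finset.sum_filter, ← Finset.sum_filter]
  refine Finset.sum_nbij' (fun y => y i) (fun z => Function.update x i z) ?_ ?_ ?_ ?_ ?_
  · intro y hy
    obtain ⟨hs, hy⟩ := Finset.mem_filter.1 hy
    exact Finset.mem_filter.2 ⟨Finset.mem_univ _, hy ▸ hs⟩
  · intro z hz
    exact Finset.mem_filter.2 ⟨(Finset.mem_filter.1 hz).2, by simp⟩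
  · intro y hy
    exact (Finset.mem_filter.1 hy).2.symm
  · intro z _
    simp
  · intro y hy
    exact congrArg F (Finset.mem_filter.1 hy).2

omit [∀ i, Nonempty (S i)] in
lemma sum_logitP (β : ℝ) (u : Fin n → (∀ i, S i) → ℝ) (x : ∀ i, S i)
    (s : Finset (∀ i, S i)) :
    ∑ y ∈ s, logitP β u x y = (1 / (n : ℝ)) *
      ∑ i, ∑ z, if Function.update x i z ∈ s then logitSigma β u i z x else 0 := by
  simp only [logitP]
  rw [← Finset.mul_sum, Finset.sum_comm]
  congr 1
  refine Finset.sum_congr rfl fun i _ => ?_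
  rw [sum_ite_eq_update x i s fun y => logitSigma β u i (y i) x]
  simp only [Function.update_self]

omit [∀ i, DecidableEq (S i)] [∀ i, Nonempty (S i)] in
lemma logitSigma_nonneg (β : ℝ) (u : Fin n → (∀ i, S i) → ℝ) (i : Fin n) (z : S i)
    (x : ∀ i, S i) : 0 ≤ logitSigma β u i z x := by
  unfold logitSigma
  positivity

omit [∀ i, Nonempty (S i)] in
lemma logitP_nonneg (β : ℝ) (u : Fin n → (∀ i, S i) → ℝ) (x y : ∀ i, S i) :
    0 ≤ logitP β u x y := by
  refine mul_nonneg (by positivity) (Finset.sum_nonneg fun i _ => ?_)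
  split_ifs
  · exact logitSigma_nonneg _ _ _ _ _
  · exact le_rfl

lemma logitP_row_sum (hn : n ≠ 0) (β : ℝ) (u : Fin n → (∀ i, S i) → ℝ) (x : ∀ i, S i) :
    ∑ y, logitP β u x y = 1 := by
  have hsigma : ∀ i, ∑ z, logitSigma β u i z x = 1 := by
    intro i
    simp only [logitSigma]
    rw [← Finset.sum_div]
    exact div_self (Finset.sum_pos (fun _ _ => Real.exp_pos _) Finset.univ_nonempty).ne'
  have hn' : (n : ℝ) ≠ 0 := Nat.cast_ne_zero.2 hn
  rw [sum_logitP]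
  simp [hsigma, hn']

omit [∀ i, Nonempty (S i)] in
lemma logitP_reversible (β : ℝ) {u : Fin n → (∀ i, S i) → ℝ} {Φ : (∀ i, S i) → ℝ}
    (hu : ∀ i x, u i x = -Φ x) (x y : ∀ i, S i) :
    Real.exp (-β * Φ x) * logitP β u x y = Real.exp (-β * Φ y) * logitP β u y x := by
  simp only [logitP]
  rw [mul_left_comm, mul_left_comm (Real.exp (-β * Φ y)), Finset.mul_sum _ _ (Real.exp _),
    Finset.mul_sum _ _ (Real.exp (-β * Φ y))]
  refine congrArg (1 / (n : ℝ) * ·) (Finset.sum_congr rfl fun i _ => ?_)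
  by_cases h : y = Function.update x i (y i)
  · have h' : x = Function.update y i (x i) := by
      rw [h]; simp
    rw [if_pos h, if_pos h']
    have hxy : ∀ z, Function.update y i z = Function.update x i z := by
      intro z
      rw [h]; simp
    simp only [logitSigma, hxy, ← h, hu, Function.update_eq_self, mul_neg, neg_mul]
    ring
  · have h' : ¬ x = Function.update y i (x i) := by
      intro h'
      apply h
      rw [h']; simp
    rw [if_neg h, if_neg h', mul_zero, mul_zero]

omit [∀ i, DecidableEq (S i)] [∀ i, Nonempty (S i)] in
lemma exp_mul_logitSigma_le (β : ℝ) {u : Fin n → (∀ i, S i) → ℝ} {Φ : (∀ i, S i) → ℝ}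
    (hu : ∀ i x, u i x = -Φ x) (i : Fin n) (z : S i) (x : ∀ i, S i) :
    Real.exp (-β * Φ x) * logitSigma β u i z x ≤
      Real.exp (-β * Φ (Function.update x i z)) := by
  have hle : Real.exp (-β * Φ x) ≤ ∑ w, Real.exp (β * u i (Function.update x i w)) := by
    have := Finset.single_le_sum (f := fun w => Real.exp (β * u i (Function.update x i w)))
      (fun w _ => (Real.exp_pos _).le) (Finset.mem_univ (x i))
    simpa [hu] using this
  have hpos := (Real.exp_pos (-β * Φ x)).trans_le hle
  unfold logitSigma
  rw [← mul_div_assoc, div_le_iff₀ hpos, hu i (Function.update x i z), mul_neg, ← neg_mul,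
    mul_comm]
  exact mul_le_mul_of_nonneg_left hle (Real.exp_pos _).le

omit [∀ i, DecidableEq (S i)] in
lemma sum_gibbs (β : ℝ) (Φ : (∀ i, S i) → ℝ) : ∑ x, gibbs β Φ x = 1 := by
  simp only [gibbs]
  rw [← Finset.sum_div]
  exact div_self (Finset.sum_pos (fun _ _ => Real.exp_pos _) Finset.univ_nonempty).ne'

end Logit

section Weight

lemma wt_le_add_card_ne (x y : Fin n → Bool) :
    wt x ≤ wt y + (Finset.univ.filter fun i => x i ≠ y i).card := by
  unfold wt
  refine le_trans (Finset.card_le_card ?_) (Finset.card_union_le _ _)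
  intro i
  simp only [Finset.mem_filter, Finset.mem_univ, true_and, Finset.mem_union]
  grind

lemma wt_update_le (x : Fin n → Bool) (i : Fin n) (z : Bool) :
    wt (Function.update x i z) ≤ wt x + 1 := by
  refine (wt_le_add_card_ne _ x).trans (Nat.add_le_add_left ?_ _)
  refine (Finset.card_le_card (t := {i}) fun j hj => ?_).trans_eq (Finset.card_singleton i)
  by_contra hji
  rw [Finset.mem_singleton] at hji
  simp [hji] at hj

lemma wt_not_add_wt (x : Fin n → Bool) : wt (fun i => !x i) + wt x = n := by
  have h := Finset.card_filter_add_card_filter_not (s := (Finset.univ : Finset (Fin n)))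
    (fun i => x i = true)
  simp only [Finset.card_univ, Fintype.card_fin] at h
  simp only [wt, Bool.not_eq_true', Bool.not_eq_true] at h ⊢
  omega

lemma wt_decide_lt {k : ℕ} (hk : k ≤ n) : wt (fun i : Fin n => decide (i.val < k)) = k := by
  simp [wt, Fin.card_filter_val_lt, hk]

lemma card_filter_wt_eq_le (k : ℕ) :
    (Finset.univ.filter fun x : Fin n → Bool => wt x = k).card ≤ n.choose k := by
  rw [← Fintype.card_fin n, ← Finset.card_univ (α := Fin n), ← Finset.card_powersetCard,
    Finset.card_univ, Fintype.card_fin]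
  refine Finset.card_le_card_of_injOn (fun x => Finset.univ.filter fun i => x i = true) ?_ ?_
  · intro x hx
    simpa [wt, Finset.mem_powersetCard] using (Finset.mem_filter.1 hx).2
  · intro x _ y _ hxy
    funext i
    have h : i ∈ (Finset.univ.filter fun i => x i = true) ↔
        i ∈ (Finset.univ.filter fun i => y i = true) := by
      rw [show (Finset.univ.filter fun i => x i = true) = _ from hxy]
    simp only [Finset.mem_filter, Finset.mem_univ, true_and] at h
    exact Bool.eq_iff_iff.2 h

lemma adjacent_decide_lt {k : ℕ} (hk : k < n) :
    Adjacent (fun i : Fin n => decide (i.val < k + 1)) (fun i => decide (i.val < k)) := by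
  unfold Adjacent
  rw [Finset.card_eq_one]
  refine ⟨⟨k, hk⟩, ?_⟩
  ext i
  simp only [Finset.mem_filter, Finset.mem_univ, true_and, Finset.mem_singleton, Fin.ext_iff,
    ne_eq, decide_eq_decide]
  omega

end Weight

section WellPotential

variable {c : ℕ} {l : ℝ} {Φ : (Fin n → Bool) → ℝ}

lemma maxVar_wellPotential (hc2 : 2 * c ≤ n) (hl : 0 < l)
    (hΦ : ∀ x, Φ x = -l * min (c : ℝ) |(c : ℝ) - (wt x : ℝ)|) :
    maxVar Φ = (c : ℝ) * l := by
  refine IsGreatest.csSup_eq ⟨?_, ?_⟩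
  · refine ⟨fun i => decide (i.val < c), fun i => decide (i.val < 0), ?_⟩
    rw [hΦ, hΦ, wt_decide_lt (by omega), wt_decide_lt (by omega)]
    simp [mul_comm]
  · rintro d ⟨x, y, rfl⟩
    have hx : 0 ≤ min (c : ℝ) |(c : ℝ) - (wt x : ℝ)| := by positivity
    have hy : min (c : ℝ) |(c : ℝ) - (wt y : ℝ)| ≤ c := min_le_left _ _
    rw [hΦ, hΦ]
    nlinarith

lemma localVar_wellPotential (hc1 : 1 ≤ c) (hc2 : 2 * c ≤ n) (hl : 0 < l)
    (hΦ : ∀ x, Φ x = -l * min (c : ℝ) |(c : ℝ) - (wt x : ℝ)|) :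
    localVar Φ = l := by
  obtain ⟨k, rfl⟩ : ∃ k, c = k + 1 := ⟨c - 1, by omega⟩
  refine IsGreatest.csSup_eq ⟨?_, ?_⟩
  · refine ⟨_, _, adjacent_decide_lt (k := k) (by omega), ?_⟩
    rw [hΦ, hΦ, wt_decide_lt (by omega), wt_decide_lt (by omega)]
    have h : (1 : ℝ) ≤ ((k + 1 : ℕ) : ℝ) := by simp
    rw [sub_self, abs_zero, min_eq_right (by positivity)]
    push_cast at h ⊢
    rw [add_sub_cancel_left, abs_one, min_eq_right h]
    ring
  · rintro d ⟨x, y, hxy, rfl⟩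
    have h1 := wt_le_add_card_ne x y
    have h2 := wt_le_add_card_ne y x
    have hxy' : (Finset.univ.filter fun i => x i ≠ y i).card = 1 := hxy
    rw [hxy'] at h1
    simp only [ne_comm (a := y _), hxy'] at h2
    have h1' : (wt x : ℝ) ≤ wt y + 1 := by exact_mod_cast h1
    have h2' : (wt y : ℝ) ≤ wt x + 1 := by exact_mod_cast h2
    have habs : |(((k + 1 : ℕ) : ℝ)) - wt y| ≤ |(((k + 1 : ℕ) : ℝ)) - wt x| + 1 := by
      have h := abs_sub_abs_le_abs_sub ((((k + 1 : ℕ) : ℝ)) - wt y) ((((k + 1 : ℕ) : ℝ)) - wt x)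
      have h' : |((((k + 1 : ℕ) : ℝ)) - wt y) - ((((k + 1 : ℕ) : ℝ)) - wt x)| ≤ 1 := by
        rw [abs_le]
        constructor <;> linarith
      linarith
    have hmin : min (((k + 1 : ℕ) : ℝ)) |(((k + 1 : ℕ) : ℝ)) - wt y| ≤
        min (((k + 1 : ℕ) : ℝ)) |(((k + 1 : ℕ) : ℝ)) - wt x| + 1 := by
      rw [← min_add_add_right]
      exact min_le_min (by linarith) habs
    rw [hΦ, hΦ]
    nlinarith

/-- Complementing a profile of weight less than `c` does not increase the potential. -/
lemma wellPotential_not_le (hc2 : 2 * c ≤ n) (hl : 0 < l)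
    (hΦ : ∀ x, Φ x = -l * min (c : ℝ) |(c : ℝ) - (wt x : ℝ)|)
    {x : Fin n → Bool} (hx : wt x < c) : Φ (fun i => !x i) ≤ Φ x := by
  have h : (wt (fun i => !x i) : ℝ) + wt x = n := by exact_mod_cast wt_not_add_wt x
  have hc2' : 2 * (c : ℝ) ≤ n := by exact_mod_cast hc2
  have hx' : (wt x : ℝ) < c := by exact_mod_cast hx
  have habs : |(c : ℝ) - wt x| ≤ |(c : ℝ) - wt (fun i => !x i)| := by
    rw [abs_of_pos (by linarith), abs_of_nonpos (by linarith)]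
    linarith
  rw [hΦ, hΦ]
  have := min_le_min (le_refl (c : ℝ)) habs
  nlinarith

lemma sum_exp_low_le_sum_exp_high (hc2 : 2 * c ≤ n) (hl : 0 < l)
    (hΦ : ∀ x, Φ x = -l * min (c : ℝ) |(c : ℝ) - (wt x : ℝ)|) {β : ℝ} (hβ : 0 ≤ β) :
    ∑ x with wt x < c, Real.exp (-β * Φ x) ≤
      ∑ x ∈ (Finset.univ.filter fun x : Fin n → Bool => wt x < c)ᶜ, Real.exp (-β * Φ x) := by
  have hinj : Function.Injective fun (x : Fin n → Bool) i => !x i := by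
    intro x y hxy
    funext i
    simpa using congrFun hxy i
  calc ∑ x with wt x < c, Real.exp (-β * Φ x)
      ≤ ∑ x : Fin n → Bool with wt x < c, Real.exp (-β * Φ (fun i => !x i)) := by
        refine Finset.sum_le_sum fun x hx => Real.exp_le_exp.2 ?_
        have := wellPotential_not_le hc2 hl hΦ (Finset.mem_filter.1 hx).2
        nlinarith
    _ = ∑ y ∈ (Finset.univ.filter fun x : Fin n → Bool => wt x < c).image
          (fun x i => !x i), Real.exp (-β * Φ y) :=
        (Finset.sum_image (f := fun y => Real.exp (-β * Φ y)) hinj.injOn).symm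
    _ ≤ _ := by
        refine Finset.sum_le_sum_of_subset_of_nonneg ?_ fun _ _ _ => (Real.exp_pos _).le
        intro y hy
        obtain ⟨x, hx, rfl⟩ := Finset.mem_image.1 hy
        have h := wt_not_add_wt x
        simp only [Finset.mem_filter, Finset.mem_univ, true_and, Finset.mem_compl] at hx ⊢
        omega

/-- The unnormalised flow of the logit dynamics across the ridge at weight `c`. -/
lemma flow_wellPotential_le (hn : n ≠ 0)
    (hΦ : ∀ x, Φ x = -l * min (c : ℝ) |(c : ℝ) - (wt x : ℝ)|)
    {u : Fin n → (Fin n → Bool) → ℝ} (hu : ∀ i x, u i x = -Φ x) (β : ℝ) :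
    ∑ x with wt x < c, Real.exp (-β * Φ x) *
      ∑ y ∈ (Finset.univ.filter fun x : Fin n → Bool => wt x < c)ᶜ, logitP β u x y ≤
      (n.choose (c - 1) : ℝ) := by
  set A := Finset.univ.filter fun x : Fin n → Bool => wt x < c with hA
  have hterm : ∀ x ∈ A, ∀ i z, Real.exp (-β * Φ x) *
      (if Function.update x i z ∈ Aᶜ then logitSigma β u i z x else 0) ≤
      if z = !x i ∧ wt x = c - 1 then 1 else 0 := by
    intro x hx i z
    by_cases h : Function.update x i z ∈ Aᶜ
    · have hle := wt_update_le x i z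
      have hzi : z = !x i := by
        by_contra hz
        have : z = x i := by simpa using hz
        rw [this, Function.update_eq_self] at h
        exact Finset.mem_compl.1 h hx
      simp only [hA, Finset.mem_compl, Finset.mem_filter, Finset.mem_univ, true_and] at hx h
      have hwt : wt (Function.update x i z) = c := by omega
      rw [if_pos (by simpa [hA] using h), if_pos ⟨hzi, by omega⟩]
      refine (exp_mul_logitSigma_le β hu i z x).trans_eq ?_
      rw [hΦ, hwt]
      simp
    · rw [if_neg h, mul_zero]
      split_ifs <;> simp
  have hrow : ∀ x ∈ A, Real.exp (-β * Φ x) * ∑ y ∈ Aᶜ, logitP β u x y ≤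
      if wt x = c - 1 then 1 else 0 := by
    intro x hx
    have hn' : (n : ℝ) ≠ 0 := Nat.cast_ne_zero.2 hn
    rw [sum_logitP, mul_left_comm, Finset.mul_sum]
    simp_rw [Finset.mul_sum _ _ (Real.exp (-β * Φ x))]
    calc (1 / (n : ℝ)) * ∑ i, ∑ z, Real.exp (-β * Φ x) *
          (if Function.update x i z ∈ Aᶜ then logitSigma β u i z x else 0)
        ≤ (1 / (n : ℝ)) * ∑ i, ∑ z, if z = !x i ∧ wt x = c - 1 then 1 else 0 :=
          mul_le_mul_of_nonneg_left (Finset.sum_le_sum fun i _ => Finset.sum_le_sum fun z _ =>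
            hterm x hx i z) (by positivity)
      _ = if wt x = c - 1 then 1 else 0 := by
          by_cases h : wt x = c - 1 <;> simp [h, hn']
  calc _ ≤ ∑ x ∈ A, if wt x = c - 1 then (1 : ℝ) else 0 := Finset.sum_le_sum hrow
    _ ≤ ∑ x : Fin n → Bool, if wt x = c - 1 then (1 : ℝ) else 0 :=
        Finset.sum_le_sum_of_subset_of_nonneg (Finset.subset_univ _)
          fun x _ _ => by split_ifs <;> simp
    _ = ((Finset.univ.filter fun x : Fin n → Bool => wt x = c - 1).card : ℝ) := by simp
    _ ≤ _ := by exact_mod_cast card_filter_wt_eq_le (c - 1)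

end WellPotential

/-- For the `n`-player potential game on `{0,1}^n` with potential
`Φ(x) = −l·min{c, |c − w(x)|}` (and utilities `u_i = −Φ`), the maximum global variation
is `ΔΦ = g = c·l`, the maximum local variation is `δΦ = l`, and for every `β ≥ 0` and
every `ε ∈ (0,1/2)`, for every integer `t < (1 − 2ε)·e^{β·g}/(2·C(n,c−1))` there is a
starting profile from which the chain at time `t` is at total variation distance more
than `ε` from the Gibbs measure. -/
theorem potential_game_mixing_lower_bound
    (n c : ℕ) (l : ℝ) (hn : 2 ≤ n) (hc1 : 1 ≤ c) (hc2 : 2 * c ≤ n) (hl : 0 < l)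
    (Φ : (Fin n → Bool) → ℝ)
    (hΦ : ∀ x, Φ x = -l * min (c : ℝ) |(c : ℝ) - (wt x : ℝ)|)
    (u : Fin n → (Fin n → Bool) → ℝ)
    (hu : ∀ i x, u i x = -Φ x) :
    maxVar Φ = (c : ℝ) * l ∧
    localVar Φ = l ∧
    (∀ β : ℝ, 0 ≤ β → ∀ ε : ℝ, 0 < ε → ε < 1 / 2 → ∀ t : ℕ,
      (t : ℝ) < (1 - 2 * ε) * Real.exp (β * ((c : ℝ) * l)) /
          (2 * (n.choose (c - 1) : ℝ)) →
      ∃ x : Fin n → Bool,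
        tvDist ((logitP β u ^ t) x) (gibbs β Φ) > ε) := by
  refine ⟨maxVar_wellPotential hc2 hl hΦ, localVar_wellPotential hc1 hc2 hl hΦ, ?_⟩
  intro β hβ ε _ hε t ht
  have hn0 : n ≠ 0 := by omega
  have hlow := sum_exp_low_le_sum_exp_high hc2 hl hΦ hβ
  have hflow := flow_wellPotential_le hn0 hΦ hu β
  have hesc := sum_weight_escape_le (logitP_nonneg β u) (logitP_row_sum hn0 β u)
    (fun x => (Real.exp_pos (-β * Φ x)).le) (logitP_reversible β hu)
    (Finset.univ.filter fun x : Fin n → Bool => wt x < c) t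
  set A := Finset.univ.filter fun x : Fin n → Bool => wt x < c with hA
  have hgibbs : 1 / 2 ≤ ∑ x ∈ Aᶜ, gibbs β Φ x := by
    have hZ : 0 < ∑ x, Real.exp (-β * Φ x) :=
      Finset.sum_pos (fun _ _ => Real.exp_pos _) Finset.univ_nonempty
    have hsplit := Finset.sum_add_sum_compl A fun x => Real.exp (-β * Φ x)
    simp only [gibbs]
    rw [← Finset.sum_div, le_div_iff₀ hZ]
    linarith
  have hwell : Real.exp (β * ((c : ℝ) * l)) ≤ ∑ x ∈ A, Real.exp (-β * Φ x) := by
    have hwt : wt (fun _ : Fin n => false) = 0 := by simp [wt]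
    have hmem : (fun _ : Fin n => false) ∈ A := by
      rw [hA, Finset.mem_filter, hwt]
      exact ⟨Finset.mem_univ _, hc1⟩
    refine le_of_eq_of_le ?_ (Finset.single_le_sum (f := fun x => Real.exp (-β * Φ x))
      (fun x _ => (Real.exp_pos _).le) hmem)
    simp only [hΦ, hwt]
    simp [mul_comm]
  have hC : 0 < (n.choose (c - 1) : ℝ) := by
    exact_mod_cast Nat.choose_pos (by omega)
  obtain ⟨x, hx⟩ : ∃ x, ∑ y ∈ Aᶜ, (logitP β u ^ t) x y < 1 / 2 - ε := by
    by_contra! hall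
    have h1 : (1 / 2 - ε) * ∑ x ∈ A, Real.exp (-β * Φ x) ≤
        ∑ x ∈ A, Real.exp (-β * Φ x) * ∑ y ∈ Aᶜ, (logitP β u ^ t) x y := by
      rw [mul_comm, Finset.sum_mul]
      exact Finset.sum_le_sum fun x _ =>
        mul_le_mul_of_nonneg_left (hall x) (Real.exp_pos _).le
    have h2 := mul_le_mul_of_nonneg_left hflow (Nat.cast_nonneg (α := ℝ) t)
    have h3 := mul_le_mul_of_nonneg_left hwell (by linarith : (0 : ℝ) ≤ 1 / 2 - ε)
    rw [lt_div_iff₀ (by positivity)] at ht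
    linarith
  refine ⟨x, ?_⟩
  have htv := sum_sub_sum_le_tvDist (μ := (logitP β u ^ t) x) (ν := gibbs β Φ)
    ((matrix_pow_row_sum (logitP_row_sum hn0 β u) t x).trans (sum_gibbs β Φ).symm) Aᶜ
  linarith
end
end
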